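/- Let H be a symmetric normalised n×n Hadamard matrix with n > 2 that satisfies the group condition (GC) and whose diagonal entries are all +1. Then there exist a permutation Σ of [n] with Σ(1) = 1 and a symmetric normalised (n/4)×(n/4) Hadamard matrix H′ satisfying (GC) such that H_{Σ,Σ} = H₄ ⊗ H′, where H₄ is the 4×4 matrix with rows (1,1,1,1), (1,1,−1,−1), (1,−1,1,−1), (1,−1,−1,1). -/

import Mathlib

open Matrix

/-- An `n × n` Hadamard matrix: entries in `{-1, 1}` and `H * Hᵀ = n • I`. -/
def IsHadamardMatrix {n : ℕ} (H : Matrix (Fin n) (Fin n) ℝ) : Prop :=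
  (∀ i j, H i j = 1 ∨ H i j = -1) ∧ H * Hᵀ = (n : ℝ) • 1

/-- `G(M, i)`: the set of rows multiplied componentwise with row `i`, together
with their negations. -/
def rowGroup {n : ℕ} (M : Matrix (Fin n) (Fin n) ℝ) (i : Fin n) : Set (Fin n → ℝ) :=
  {v | ∃ j : Fin n, v = M j * M i ∨ v = -(M j * M i)}

/-- The group condition (GC): `G(H, i) = G(H, 1)` and `G(Hᵀ, i) = G(Hᵀ, 1)` for all `i`. -/
def GroupCond {n : ℕ} (H : Matrix (Fin n) (Fin n) ℝ) : Prop :=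
  (∀ i i₀ : Fin n, i₀.1 = 0 → rowGroup H i = rowGroup H i₀) ∧
  (∀ i i₀ : Fin n, i₀.1 = 0 → rowGroup Hᵀ i = rowGroup Hᵀ i₀)

/-- `H` is normalised: first row and first column consist entirely of `+1`s. -/
def Normalised {n : ℕ} (H : Matrix (Fin n) (Fin n) ℝ) : Prop :=
  ∀ i j : Fin n, (i.1 = 0 → H i j = 1) ∧ (j.1 = 0 → H i j = 1)

/-- Kronecker (tensor) product with explicit row-major indexing:
`(B ⊗ C)_{(k-1)t+i, (ℓ-1)u+j} = B_{k,ℓ} C_{i,j}`. -/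
def kron {r t : ℕ} (B : Matrix (Fin r) (Fin r) ℝ) (C : Matrix (Fin t) (Fin t) ℝ) :
    Matrix (Fin (r * t)) (Fin (r * t)) ℝ :=
  fun i j => B i.divNat j.divNat * C i.modNat j.modNat

/-- The 4 × 4 Hadamard matrix `H₄`. -/
def H4 : Matrix (Fin 4) (Fin 4) ℝ :=
  !![1, 1, 1, 1; 1, 1, -1, -1; 1, -1, 1, -1; 1, -1, -1, 1]

theorem IsHadamardMatrix.mul_self {n : ℕ} {H : Matrix (Fin n) (Fin n) ℝ}
    (hH : IsHadamardMatrix H) (i j : Fin n) : H i j * H i j = 1 := by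
  rcases hH.1 i j with h | h <;> simp [h]

theorem IsHadamardMatrix.sum_mul {n : ℕ} {H : Matrix (Fin n) (Fin n) ℝ}
    (hH : IsHadamardMatrix H) (i j : Fin n) :
    ∑ k, H i k * H j k = if i = j then (n : ℝ) else 0 := by
  have h := congrFun (congrFun hH.2 i) j
  simpa [Matrix.mul_apply, Matrix.smul_apply, Matrix.one_apply] using h

theorem IsHadamardMatrix.row_injective {n : ℕ} {H : Matrix (Fin n) (Fin n) ℝ}
    (hH : IsHadamardMatrix H) {i j : Fin n} (h : ∀ k, H i k = H j k) : i = j := by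
  by_contra hij
  have h1 := hH.sum_mul i j
  rw [if_neg hij] at h1
  have h2 := hH.sum_mul j j
  simp only [if_true] at h2
  simp only [h] at h1
  rw [h1] at h2
  have : n = 0 := by exact_mod_cast h2.symm
  exact absurd i.2 (by omega)

/-- The rows of a normalised matrix satisfying (GC) are closed under multiplication. -/
theorem GroupCond.exists_row_mul {n : ℕ} {H : Matrix (Fin n) (Fin n) ℝ}
    (hGC : GroupCond H) (hnorm : Normalised H) (i j : Fin n) :
    ∃ k, ∀ c, H k c = H i c * H j c := by
  let o : Fin n := ⟨0, by have := i.2; omega⟩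
  have hmem : H i * H j ∈ rowGroup H o := by
    rw [← hGC.1 j o rfl]
    exact ⟨i, Or.inl rfl⟩
  obtain ⟨k, hk | hk⟩ := hmem
  · refine ⟨k, fun c => ?_⟩
    have h := congrFun hk c
    simp only [Pi.mul_apply, (hnorm o c).1 rfl, mul_one] at h
    exact h.symm
  · have h := congrFun hk o
    simp only [Pi.mul_apply, Pi.neg_apply, (hnorm _ o).2 rfl] at h
    norm_num at h

/-- Conversely, closure of the rows under multiplication gives (GC) in the symmetric case. -/
theorem groupCond_of_exists_row_mul {n : ℕ} {H : Matrix (Fin n) (Fin n) ℝ}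
    (hsq : ∀ i j, H i j * H i j = 1) (hsymm : H.IsSymm) (hnorm : Normalised H)
    (hmul : ∀ i j, ∃ k, ∀ c, H k c = H i c * H j c) : GroupCond H := by
  have key : ∀ i i₀ : Fin n, i₀.1 = 0 → rowGroup H i = rowGroup H i₀ := by
    intro i i₀ h0
    ext v
    constructor
    · rintro ⟨j, hj⟩
      obtain ⟨k, hk⟩ := hmul j i
      have : H j * H i = H k * H i₀ := by
        ext c
        simp [hk, (hnorm i₀ c).1 h0]
      exact ⟨k, by rwa [← this]⟩
    · rintro ⟨j, hj⟩
      obtain ⟨k, hk⟩ := hmul j i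
      have : H j * H i₀ = H k * H i := by
        ext c
        simp [hk, (hnorm i₀ c).1 h0, mul_assoc, hsq]
      exact ⟨k, by rwa [← this]⟩
  exact ⟨key, by rw [hsymm.eq]; exact key⟩

theorem H4_col_injective {k l : Fin 4} (h : ∀ r, H4 r k = H4 r l) : k = l := by
  have h1 : (![1, 1, -1, -1] : Fin 4 → ℝ) k = ![1, 1, -1, -1] l := h 1
  have h2 : (![1, -1, 1, -1] : Fin 4 → ℝ) k = ![1, -1, 1, -1] l := h 2
  clear h
  fin_cases k <;> fin_cases l <;>
    first | rfl | (norm_num at h1; done) | (norm_num at h2; done)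

theorem Fintype.exists_equiv_fin_apply_zero {α : Type*} [Fintype α] (a : α)
    (h : 0 < Fintype.card α) : ∃ e : Fin (Fintype.card α) ≃ α, e ⟨0, h⟩ = a := by
  let e := (Fintype.equivFin α).symm
  exact ⟨(Equiv.swap ⟨0, h⟩ (e.symm a)).trans e, by simp⟩

theorem stmt6 {n : ℕ} (hn : 2 < n) (H : Matrix (Fin n) (Fin n) ℝ)
    (hH : IsHadamardMatrix H) (hsymm : H.IsSymm) (hnorm : Normalised H)
    (hGC : GroupCond H) (hdiag : ∀ i : Fin n, H i i = 1) :
    ∃ (σ : Equiv.Perm (Fin n)) (m : ℕ) (hm : n = 4 * m)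
      (H' : Matrix (Fin m) (Fin m) ℝ),
      σ ⟨0, by omega⟩ = ⟨0, by omega⟩ ∧
      IsHadamardMatrix H' ∧ H'.IsSymm ∧ Normalised H' ∧ GroupCond H' ∧
      ∀ i j : Fin n, H (σ i) (σ j) = kron H4 H' (Fin.cast hm i) (Fin.cast hm j) := by
  classical
  choose p hp using fun i j => hGC.exists_row_mul hnorm i j
  have hs : ∀ i j, H i j = H j i := fun i j => hsymm.apply j i
  have hp' : ∀ i j c, H c (p i j) = H c i * H c j := fun i j c => by
    rw [hs, hp, hs i, hs j]
  have hsq := hH.mul_self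
  set o : Fin n := ⟨0, by omega⟩ with ho
  have ho1 : ∀ c, H o c = 1 := fun c => (hnorm o c).1 rfl
  have ho2 : ∀ c, H c o = 1 := fun c => (hnorm c o).2 rfl
  obtain ⟨e, he⟩ : ∃ e : Fin n, e ≠ o := ⟨⟨1, by omega⟩, by simp [ho]⟩
  obtain ⟨f, hef⟩ : ∃ f, H e f = -1 := by
    by_contra! h
    exact he (hH.row_injective fun k => by
      rw [ho1]; exact (hH.1 e k).resolve_right (h k))
  have hfe : H f e = -1 := by rw [hs, hef]
  let t : Fin 4 → Fin n := ![o, e, f, p e f]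
  have ht : ∀ k l, H (t k) (t l) = H4 k l := by
    intro k l
    fin_cases k <;> fin_cases l <;>
      simp [t, H4, ho1, ho2, hdiag, hef, hfe, hp, hp']
  let W := {x : Fin n // H e x = 1 ∧ H f x = 1}
  have htW : ∀ k (w : W), H (t k) w = 1 := by
    rintro k ⟨w, h1, h2⟩
    fin_cases k <;> simp [t, ho1, hp, h1, h2]
  have hcancel : ∀ a b, p a (p a b) = b := fun a b => hH.row_injective fun c => by
    rw [hp, hp, ← mul_assoc, hsq, one_mul]
  let φ : Fin 4 × W → Fin n := fun x => p (t x.1) x.2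
  have hφ : Function.Bijective φ := by
    constructor
    · rintro ⟨k, w⟩ ⟨l, w'⟩ h
      have h4 : ∀ r, H4 r k = H4 r l := fun r => by
        have := congrArg (H (t r)) h
        simpa [φ, hp', ht, htW] using this
      have hkl : k = l := H4_col_injective h4
      subst hkl
      have : (w : Fin n) = w' := by
        rw [← hcancel (t k) w, ← hcancel (t k) w']
        exact congrArg (p (t k)) h
      rw [Subtype.ext this]
    · intro x
      obtain ⟨k, hk1, hk2⟩ : ∃ k, H e (t k) = H e x ∧ H f (t k) = H f x := by
        rcases hH.1 e x with h1 | h1 <;> rcases hH.1 f x with h2 | h2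
        · exact ⟨0, by simp [t, ho2, h1, h2]⟩
        · exact ⟨1, by simp [t, hdiag, hfe, h1, h2]⟩
        · exact ⟨2, by simp [t, hdiag, hef, h1, h2]⟩
        · exact ⟨3, by simp [t, hp', hdiag, hef, hfe, h1, h2]⟩
      exact ⟨(k, ⟨p (t k) x, by rw [hp', hk1, hsq], by rw [hp', hk2, hsq]⟩), hcancel _ _⟩
  let w₀ : W := ⟨o, ho2 e, ho2 f⟩
  have hpos : 0 < Fintype.card W := Fintype.card_pos_iff.2 ⟨w₀⟩
  obtain ⟨w, hw⟩ := Fintype.exists_equiv_fin_apply_zero w₀ hpos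
  have hm : n = 4 * Fintype.card W := by
    simpa using (Fintype.card_of_bijective hφ).symm
  let ψ : Fin 4 × Fin (Fintype.card W) ≃ Fin n :=
    ((Equiv.refl _).prodCongr w).trans (Equiv.ofBijective φ hφ)
  have hψ : ∀ k i, ψ (k, i) = p (t k) (w i) := fun _ _ => rfl
  let H' : Matrix (Fin (Fintype.card W)) (Fin (Fintype.card W)) ℝ :=
    fun i j => H (w i) (w j)
  have hψH : ∀ k i l j, H (ψ (k, i)) (ψ (l, j)) = H4 k l * H' i j := by
    intro k i l j
    rw [hψ, hψ, hp, hp', hp', ht, htW, hs (w i) (t l), htW]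
    simp [H']
  have hsymm' : H'.IsSymm := by
    ext i j
    exact hs _ _
  have hw0 : ∀ i, i.1 = 0 → (w i : Fin n) = o := by
    intro i hi
    have : i = ⟨0, hpos⟩ := Fin.ext hi
    rw [this, hw]
  have hnorm' : Normalised H' := by
    intro i j
    exact ⟨fun hi => by simp [H', hw0 i hi, ho1], fun hj => by simp [H', hw0 j hj, ho2]⟩
  refine ⟨((finCongr hm).trans finProdFinEquiv.symm).trans ψ, Fintype.card W, hm, H', ?_, ?_,
    hsymm', hnorm', ?_, ?_⟩
  · have h0 : finProdFinEquiv.symm (finCongr hm o) = ((0 : Fin 4), (⟨0, hpos⟩ : Fin _)) := by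
      rw [Equiv.symm_apply_eq]
      ext
      simp [ho]
    change ψ (finProdFinEquiv.symm (finCongr hm o)) = o
    rw [h0, hψ, hw]
    exact hH.row_injective fun c => by simp [hp, t, w₀, ho1]
  · refine ⟨fun i j => hH.1 _ _, ?_⟩
    ext i j
    have h := hH.sum_mul (ψ (0, i)) (ψ (0, j))
    rw [← Equiv.sum_comp ψ, Fintype.sum_prod_type] at h
    simp only [hψH, ψ.injective.eq_iff, Prod.mk.injEq, true_and] at h
    have hn' : (n : ℝ) = 4 * (Fintype.card W : ℝ) := by exact_mod_cast hm
    simp [Fin.sum_univ_four, H4, hn'] at h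
    simp only [Matrix.mul_apply, Matrix.transpose_apply, Matrix.smul_apply, Matrix.one_apply,
      smul_eq_mul, mul_ite, mul_one, mul_zero]
    split_ifs at h ⊢ <;> linarith
  · refine groupCond_of_exists_row_mul (fun i j => hsq _ _) hsymm' hnorm' fun i j => ?_
    refine ⟨w.symm ⟨p (w i) (w j), ?_, ?_⟩, fun c => ?_⟩
    · rw [hp', (w i).2.1, (w j).2.1, one_mul]
    · rw [hp', (w i).2.2, (w j).2.2, one_mul]
    · simp [H', hp]
  · intro i j
    exact hψH _ _ _ _
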